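/- Let τ be a faithful positive tracial state on ℂ⟨X⟩ and (P_w)_{w∈⟨X⟩_d} a family of orthonormal polynomials of τ at degree d. Then, in the algebraic tensor product ℂ⟨X⟩ ⊗ ℂ⟨X⟩, one has Σ_{w∈⟨X⟩_d} P_w ⊗ P_w⋆ = Σ_{w∈⟨X⟩_d} P_w⋆ ⊗ P_w. -/

import Mathlib

open scoped ComplexOrder Matrix

namespace NCCD

/-- Words in the letters `X_1, …, X_n`, i.e. elements of the free monoid on `n` generators. -/
abbrev Word (n : ℕ) : Type := FreeMonoid (Fin n)

/-- The free unital `*`-algebra `ℂ⟨X_1, …, X_n⟩`, modeled as the monoid algebra of the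
free monoid on `n` generators. -/
abbrev NCPoly (n : ℕ) : Type := MonoidAlgebra ℂ (Word n)

/-- The monomial associated to a word. -/
noncomputable def mono {n : ℕ} (w : Word n) : NCPoly n :=
  MonoidAlgebra.of ℂ (Word n) w

/-- The length of a word. -/
def wlen {n : ℕ} (w : Word n) : ℕ := (FreeMonoid.toList w).length

/-- The involution `⋆` on `ℂ⟨X⟩`: conjugate the coefficients and reverse the words. -/
noncomputable def ncStar {n : ℕ} (f : NCPoly n) : NCPoly n :=
  MonoidAlgebra.ofCoeff (Finsupp.mapDomain (fun w => FreeMonoid.ofList (FreeMonoid.toList w).reverse)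
    (Finsupp.mapRange (starRingEnd ℂ) (map_zero _) f.coeff))

/-- `τ` is a positive functional: `τ(f⋆ f) ≥ 0` for all `f`. -/
def IsPositive {n : ℕ} (τ : NCPoly n →ₗ[ℂ] ℂ) : Prop :=
  ∀ f : NCPoly n, 0 ≤ τ (ncStar f * f)

/-- `τ` is tracial: `τ(fg) = τ(gf)`. -/
def IsTracial {n : ℕ} (τ : NCPoly n →ₗ[ℂ] ℂ) : Prop :=
  ∀ f g : NCPoly n, τ (f * g) = τ (g * f)

/-- `τ` is faithful: `τ(f⋆ f) = 0` implies `f = 0`. -/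
def IsFaithful {n : ℕ} (τ : NCPoly n →ₗ[ℂ] ℂ) : Prop :=
  ∀ f : NCPoly n, τ (ncStar f * f) = 0 → f = 0

/-- The strict graded lexicographic order on words. -/
def glLt {n : ℕ} (v w : Word n) : Prop :=
  wlen v < wlen w ∨
    (wlen v = wlen w ∧ List.Lex (· < ·) (FreeMonoid.toList v) (FreeMonoid.toList w))

/-- The graded lexicographic order on words. -/
def glLe {n : ℕ} (v w : Word n) : Prop := glLt v w ∨ v = w

/-- Words of length at most `d`. -/
abbrev WordLE (n d : ℕ) : Type := {w : Word n // wlen w ≤ d}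

instance {n : ℕ} : DecidableEq (Word n) := fun a b =>
  decidable_of_iff (FreeMonoid.toList a = FreeMonoid.toList b)
    ⟨fun h => FreeMonoid.toList.injective h, fun h => by rw [h]⟩

instance (n d : ℕ) : Finite (WordLE n d) := by
  apply Finite.of_surjective
    (f := fun p : (k : Fin (d+1)) × (Fin k → Fin n) =>
      (⟨FreeMonoid.ofList (List.ofFn p.2), by simp [wlen]; omega⟩ : WordLE n d))
  rintro ⟨w, hw⟩
  refine ⟨⟨⟨wlen w, by omega⟩, fun i => (FreeMonoid.toList w).get ⟨i, i.2⟩⟩, ?_⟩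
  apply Subtype.ext
  simp [wlen, List.ofFn_get]

noncomputable instance (n d : ℕ) : Fintype (WordLE n d) := Fintype.ofFinite _

/-- The span `ℂ⟨X⟩_d` of the monomials of degree at most `d`. -/
noncomputable def degLE (n d : ℕ) : Submodule ℂ (NCPoly n) :=
  Submodule.span ℂ {p : NCPoly n | ∃ w : Word n, wlen w ≤ d ∧ p = mono w}

end NCCD

namespace NCCD

/-- A family of orthonormal polynomials of a faithful positive tracial state `τ` at degree `d`:
a family `(P_w)` in `ℂ⟨X⟩_d` with `P_1 = 1`, `τ(P_v⋆ P_w) = δ_{v,w}`, `τ(P_v⋆ w) = 0` whenever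
`w <_gl v`, and `τ(P_w⋆ w) > 0`, for all words `v, w` of length at most `d`. -/
def IsONB {n : ℕ} (τ : NCPoly n →ₗ[ℂ] ℂ) (d : ℕ) (P : Word n → NCPoly n) : Prop :=
  (∀ w : Word n, wlen w ≤ d → P w ∈ degLE n d) ∧
  P 1 = 1 ∧
  (∀ v w : Word n, wlen v ≤ d → wlen w ≤ d →
    τ (ncStar (P v) * P w) = if v = w then 1 else 0) ∧
  (∀ v w : Word n, wlen v ≤ d → wlen w ≤ d → glLt w v → τ (ncStar (P v) * mono w) = 0) ∧
  (∀ w : Word n, wlen w ≤ d → 0 < τ (ncStar (P w) * mono w))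

end NCCD

namespace NCCD

open TensorProduct

lemma ncStar_zero {n : ℕ} : ncStar (0 : NCPoly n) = 0 := by
  simp [ncStar]

lemma ncStar_add {n : ℕ} (f g : NCPoly n) : ncStar (f + g) = ncStar f + ncStar g := by
  unfold ncStar
  rw [MonoidAlgebra.coeff_add, Finsupp.mapRange_add (by simp), Finsupp.mapDomain_add,
    MonoidAlgebra.ofCoeff_add]

lemma ncStar_smul {n : ℕ} (c : ℂ) (f : NCPoly n) :
    ncStar (c • f) = (starRingEnd ℂ c) • ncStar f := by
  unfold ncStar
  rw [MonoidAlgebra.coeff_smul, Finsupp.mapRange_smul' (d := starRingEnd ℂ c) c f.coeff (by simp),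
    Finsupp.mapDomain_smul, MonoidAlgebra.ofCoeff_smul]

lemma ncStar_mono {n : ℕ} (w : Word n) :
    ncStar (mono w) = mono (FreeMonoid.ofList (FreeMonoid.toList w).reverse) := by
  simp [ncStar, mono]

lemma ncStar_mem {n d : ℕ} {f : NCPoly n} (hf : f ∈ degLE n d) : ncStar f ∈ degLE n d := by
  unfold degLE at hf
  induction hf using Submodule.span_induction with
  | mem x hx =>
    obtain ⟨w, hw, rfl⟩ := hx
    rw [ncStar_mono]
    exact Submodule.subset_span ⟨_, by simpa [wlen] using hw, rfl⟩
  | zero => rw [ncStar_zero]; exact zero_mem _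
  | add x y _ _ hx hy => rw [ncStar_add]; exact add_mem hx hy
  | smul c x _ hx => rw [ncStar_smul]; exact Submodule.smul_mem _ _ hx

lemma expand {n : ℕ} (τ : NCPoly n →ₗ[ℂ] ℂ) (d : ℕ) (P : Word n → NCPoly n)
    (hmem : ∀ w : Word n, wlen w ≤ d → P w ∈ degLE n d)
    (horth : ∀ v w : Word n, wlen v ≤ d → wlen w ≤ d →
      τ (ncStar (P v) * P w) = if v = w then 1 else 0)
    {f : NCPoly n} (hf : f ∈ degLE n d) :
    f = ∑ w : WordLE n d, τ (ncStar (P w.1) * f) • P w.1 := by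
  have key : ∀ (g : WordLE n d → ℂ) (v : WordLE n d),
      τ (ncStar (P v.1) * ∑ w, g w • P w.1) = g v := by
    intro g v
    rw [Finset.mul_sum, map_sum, Finset.sum_eq_single v]
    · simp [horth v.1 v.1 v.2 v.2]
    · intro w _ hne
      have : v.1 ≠ w.1 := fun h => hne (Subtype.ext h.symm)
      simp [horth v.1 w.1 v.2 w.2, this]
    · simp
  have hli : LinearIndependent ℂ (fun w : WordLE n d => P w.1) := by
    rw [Fintype.linearIndependent_iff]
    intro g hg v
    rw [← key g v, hg]; simp
  have hdeg : degLE n d = Submodule.span ℂ (Set.range fun w : WordLE n d => mono w.1) := by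
    unfold degLE
    congr 1
    ext p
    constructor
    · rintro ⟨w, hw, rfl⟩; exact ⟨⟨w, hw⟩, rfl⟩
    · rintro ⟨w, rfl⟩; exact ⟨w.1, w.2, rfl⟩
  have hfd : FiniteDimensional ℂ (degLE n d) := by
    rw [hdeg]; exact FiniteDimensional.span_of_finite ℂ (Set.finite_range _)
  have hspan : Submodule.span ℂ (Set.range fun w : WordLE n d => P w.1) = degLE n d := by
    apply Submodule.eq_of_le_of_finrank_le
    · rw [Submodule.span_le]; rintro _ ⟨w, rfl⟩; exact hmem w.1 w.2
    · rw [finrank_span_eq_card hli, hdeg]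
      exact finrank_range_le_card (R := ℂ) (fun w : WordLE n d => mono w.1)
  rw [← hspan, Submodule.mem_span_range_iff_exists_fun] at hf
  obtain ⟨g, rfl⟩ := hf
  exact Finset.sum_congr rfl fun v _ => by rw [key]

/-- For a family `(P_w)` of orthonormal polynomials of a faithful positive
tracial state `τ` at degree `d`, one has `Σ_w P_w ⊗ P_w⋆ = Σ_w P_w⋆ ⊗ P_w` in
`ℂ⟨X⟩ ⊗ ℂ⟨X⟩`. -/
theorem cd_kernel_tensor_symmetric {n : ℕ} (τ : NCPoly n →ₗ[ℂ] ℂ)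
    (hpos : IsPositive τ) (htr : IsTracial τ) (hstate : τ 1 = 1) (hfaith : IsFaithful τ)
    (d : ℕ) (P : Word n → NCPoly n) (hONB : IsONB τ d P) :
    ∑ w : WordLE n d, (P w.1) ⊗ₜ[ℂ] (ncStar (P w.1)) =
      ∑ w : WordLE n d, (ncStar (P w.1)) ⊗ₜ[ℂ] (P w.1) := by
  obtain ⟨hmem, -, horth, -, -⟩ := hONB
  have hexp : ∀ v : WordLE n d, ncStar (P v.1) =
      ∑ w : WordLE n d, τ (ncStar (P w.1) * ncStar (P v.1)) • P w.1 := fun v =>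
    expand τ d P hmem horth (ncStar_mem (hmem v.1 v.2))
  have hR : ∀ v : WordLE n d, ncStar (P v.1) ⊗ₜ[ℂ] P v.1 =
      ∑ w : WordLE n d, τ (ncStar (P w.1) * ncStar (P v.1)) • (P w.1 ⊗ₜ[ℂ] P v.1) := by
    intro v
    conv_lhs => rw [hexp v]
    simp only [TensorProduct.sum_tmul, TensorProduct.smul_tmul']
  have hL : ∀ w : WordLE n d, P w.1 ⊗ₜ[ℂ] ncStar (P w.1) =
      ∑ v : WordLE n d, τ (ncStar (P w.1) * ncStar (P v.1)) • (P w.1 ⊗ₜ[ℂ] P v.1) := by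
    intro w
    conv_lhs => rw [hexp w]
    rw [TensorProduct.tmul_sum]
    exact Finset.sum_congr rfl fun v _ => by rw [TensorProduct.tmul_smul, htr]
  rw [Finset.sum_congr rfl fun w _ => hL w, Finset.sum_congr rfl fun w _ => hR w]
  exact Finset.sum_comm

end NCCD
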